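/- Let K_0 ∈ ℕ satisfy K_0 ≥ K and the property that for all x, y ∈ X, if x_i = y_i for all 0 ≤ i ≤ K_0 then d_X(x, y) < β/4. Then there exists ε_Y with 0 < ε_Y < β/4 such that for every x ∈ X one has φ^{K_0}(X^u(x, ε_Y)) ⊆ X^u(φ^{K_0}(x), β/4). -/

import Mathlib

open Filter Topology

variable {Y : Type*} [MetricSpace Y]

/-- The inverse limit (solenoid) space of a map `g : Y → Y`. -/
abbrev Solenoid (g : Y → Y) : Type _ := {x : ℕ → Y // ∀ n, g (x (n + 1)) = x n}

namespace Solenoid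

variable {g : Y → Y}

/-- The map `φ(x₀, x₁, …) = (g x₀, x₀, x₁, …)`. -/
def phi (x : Solenoid g) : Solenoid g :=
  ⟨fun n => Nat.casesOn n (g (x.1 0)) fun k => x.1 k, by
    intro n
    cases n with
    | zero => rfl
    | succ k => exact x.2 k⟩

/-- The left shift, the inverse of `phi`. -/
def shift (x : Solenoid g) : Solenoid g :=
  ⟨fun n => x.1 (n + 1), fun n => x.2 (n + 1)⟩

/-- `d'_X(x, y) = sup_n γ^n d_Y(x_n, y_n)`. -/
noncomputable def dX' (γ : ℝ) (x y : Solenoid g) : ℝ :=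
  ⨆ n : ℕ, γ ^ n * dist (x.1 n) (y.1 n)

/-- `d_X(x, y) = Σ_{i=0}^{K} γ^i d'_X(φ^i x, φ^i y)`. -/
noncomputable def dX (γ : ℝ) (K : ℕ) (x y : Solenoid g) : ℝ :=
  ∑ i ∈ Finset.range (K + 1), γ ^ i * dX' γ (phi^[i] x) (phi^[i] y)

/-- The local unstable set `X^u(x, ε)`. -/
def locUnstable (γ : ℝ) (K : ℕ) (x : Solenoid g) (ε : ℝ) : Set (Solenoid g) :=
  {y | (∀ n, dist (x.1 n) (y.1 n) < ε) ∧ dX γ K x y ≤ ε}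

/-- Stable equivalence `x ∼ₛ y`. -/
def stableEquiv (γ : ℝ) (K : ℕ) (x y : Solenoid g) : Prop :=
  Tendsto (fun n => dX γ K (phi^[n] x) (phi^[n] y)) atTop (𝓝 0)

/-- Unstable equivalence `x ∼ᵤ y`. -/
def unstableEquiv (γ : ℝ) (K : ℕ) (x y : Solenoid g) : Prop :=
  Tendsto (fun n => dX γ K (shift^[n] x) (shift^[n] y)) atTop (𝓝 0)

/-- `X^u(P)`, the union of the unstable equivalence classes of points of `P`. -/
def XuP (γ : ℝ) (K : ℕ) (P : Set (Solenoid g)) : Set (Solenoid g) :=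
  {x | ∃ p ∈ P, unstableEquiv γ K x p}

/-- The relation `x ∼₀ y`. -/
def equiv0 (γ : ℝ) (K : ℕ) (εY : ℝ) (x y : Solenoid g) : Prop :=
  x.1 0 = y.1 0 ∧
    ∃ δ, 0 < δ ∧ δ < εY ∧
      ∃ U ⊆ locUnstable γ K y εY,
        (∃ V : Set (Solenoid g), IsOpen V ∧ U = V ∩ locUnstable γ K y εY) ∧
        (fun z : Solenoid g => z.1 0) '' locUnstable γ K x δ
          = (fun z : Solenoid g => z.1 0) '' U

end Solenoid

namespace Solenoid

theorem exists_forall_dist_phi_iterate_lt {Y : Type*} [MetricSpace Y] {g : Y → Y}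
    (hg : UniformContinuous g) (M : ℕ) {δ : ℝ} (hδ : 0 < δ) :
    ∃ ε, 0 < ε ∧ ∀ x y : Solenoid g, (∀ n, dist (x.1 n) (y.1 n) < ε) →
      ∀ m ≤ M, ∀ n, dist ((phi^[m] x).1 n) ((phi^[m] y).1 n) < δ := by
  induction M generalizing δ with
  | zero =>
    refine ⟨δ, hδ, fun x y h m hm n => ?_⟩
    obtain rfl : m = 0 := by omega
    exact h n
  | succ M ih =>
    obtain ⟨η, hη, hgη⟩ := Metric.uniformContinuous_iff.1 hg δ hδ
    obtain ⟨ε, hε, h⟩ := ih (lt_min hη hδ)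
    refine ⟨ε, hε, fun x y hxy m hm n => ?_⟩
    rcases Nat.lt_or_ge M m with hMm | hmM
    · obtain rfl : m = M + 1 := by omega
      rw [Function.iterate_succ_apply', Function.iterate_succ_apply']
      have hM := h x y hxy M le_rfl
      cases n with
      | zero => exact hgη ((hM 0).trans_le (min_le_left _ _))
      | succ k => exact (hM k).trans_le (min_le_right _ _)
    · exact (h x y hxy m hmM n).trans_le (min_le_right _ _)

theorem dX'_le {Y : Type*} [MetricSpace Y] {g : Y → Y} {γ : ℝ} (hγ0 : 0 ≤ γ) (hγ1 : γ ≤ 1)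
    {x y : Solenoid g} {δ : ℝ} (h : ∀ n, dist (x.1 n) (y.1 n) ≤ δ) : dX' γ x y ≤ δ :=
  ciSup_le fun n =>
    (mul_le_of_le_one_left dist_nonneg (pow_le_one₀ hγ0 hγ1)).trans (h n)

theorem dX_le {Y : Type*} [MetricSpace Y] {g : Y → Y} {γ : ℝ} (hγ0 : 0 ≤ γ) (hγ1 : γ ≤ 1)
    {K : ℕ} {x y : Solenoid g} {δ : ℝ}
    (h : ∀ i ≤ K, ∀ n, dist ((phi^[i] x).1 n) ((phi^[i] y).1 n) ≤ δ) :
    dX γ K x y ≤ (K + 1) * δ := by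
  have hδ : 0 ≤ δ := dist_nonneg.trans (h 0 (Nat.zero_le K) 0)
  have hterm : ∀ i ∈ Finset.range (K + 1), γ ^ i * dX' γ (phi^[i] x) (phi^[i] y) ≤ δ := by
    intro i hi
    have hi' : i ≤ K := Nat.lt_succ_iff.1 (Finset.mem_range.1 hi)
    calc γ ^ i * dX' γ (phi^[i] x) (phi^[i] y)
        ≤ γ ^ i * δ := mul_le_mul_of_nonneg_left (dX'_le hγ0 hγ1 (h i hi')) (pow_nonneg hγ0 i)
      _ ≤ δ := mul_le_of_le_one_left hδ (pow_le_one₀ hγ0 hγ1)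
  simpa [dX] using Finset.sum_le_card_nsmul _ _ δ hterm

end Solenoid

theorem exists_epsilonY
    {Y : Type*} [MetricSpace Y] [CompactSpace Y]
    (g : Y → Y) (hgc : Continuous g) (hgs : Function.Surjective g)
    (β γ : ℝ) (K : ℕ) (hβ : 0 < β) (hK : 1 ≤ K) (hγ0 : 0 < γ) (hγ1 : γ < 1)
    (hax1 : ∀ x y : Y, dist x y ≤ β →
      dist (g^[K] x) (g^[K] y) ≤ γ ^ K * dist (g^[2 * K] x) (g^[2 * K] y))
    (hax2 : ∀ (x : Y) (ε : ℝ), 0 < ε → ε ≤ β →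
      g^[K] '' Metric.ball (g^[K] x) ε ⊆ g^[2 * K] '' Metric.ball x (γ * ε))
    (K₀ : ℕ) (hK₀K : K ≤ K₀)
    (hK₀ : ∀ x y : Solenoid g, (∀ i ≤ K₀, x.1 i = y.1 i) → Solenoid.dX γ K x y < β / 4) :
    ∃ εY : ℝ, 0 < εY ∧ εY < β / 4 ∧
      ∀ x : Solenoid g,
        Solenoid.phi^[K₀] '' Solenoid.locUnstable γ K x εY ⊆
          Solenoid.locUnstable γ K (Solenoid.phi^[K₀] x) (β / 4) := by
  have hK1 : (0 : ℝ) < K + 1 := by positivity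
  have hδ : 0 < β / 4 / (K + 1) := by positivity
  obtain ⟨ε, hε, h⟩ := Solenoid.exists_forall_dist_phi_iterate_lt
    (CompactSpace.uniformContinuous_of_continuous hgc) (K + K₀) hδ
  refine ⟨min ε (β / 8), lt_min hε (by positivity),
    (min_le_right _ _).trans_lt (by linarith), ?_⟩
  rintro x _ ⟨y, ⟨hxy, -⟩, rfl⟩
  have hdist := h x y fun n => (hxy n).trans_le (min_le_left _ _)
  refine ⟨fun n => (hdist K₀ (Nat.le_add_left _ _) n).trans_le
    (div_le_self (by positivity) (by simp)), ?_⟩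
  calc Solenoid.dX γ K (Solenoid.phi^[K₀] x) (Solenoid.phi^[K₀] y)
      ≤ (K + 1) * (β / 4 / (K + 1)) := Solenoid.dX_le hγ0.le hγ1.le fun i hi n => by
        rw [← Function.iterate_add_apply, ← Function.iterate_add_apply]
        exact (hdist (i + K₀) (by omega) n).le
    _ = β / 4 := mul_div_cancel₀ _ hK1.ne'
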